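/- Let b₀ > 0 and ε > 0 be real numbers, and let b₁, μ ∈ ℂ with Re b₁ > 0 and Re μ > 0. Then the integral ∫_ε^∞ t^{b₁−1} e^{−μ t^{b₀}} dt converges absolutely and satisfies |∫_ε^∞ t^{b₁−1} e^{−μ t^{b₀}} dt| ≤ (Γ((Re b₁)/b₀)/b₀) · (2/Re μ)^{(Re b₁)/b₀} · e^{−(Re μ)·ε^{b₀}/2}. -/

import Mathlib

open MeasureTheory Real Set

noncomputable section

/-- On `(ε, ∞)` half of the exponential decay can be traded for the value at the endpoint `ε`. -/
theorem norm_cpow_mul_exp_neg_mul_rpow_le {b₀ ε t : ℝ} (hb₀ : 0 ≤ b₀) (hε : 0 ≤ ε) (ht : ε < t)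
    (b₁ : ℂ) {μ : ℂ} (hμ : 0 ≤ μ.re) :
    ‖(t : ℂ) ^ (b₁ - 1) * Complex.exp (-μ * ((t ^ b₀ : ℝ) : ℂ))‖ ≤
      Real.exp (-(μ.re * ε ^ b₀) / 2) *
        (t ^ (b₁.re - 1) * Real.exp (-(μ.re / 2) * t ^ b₀)) := by
  have ht0 : 0 < t := hε.trans_lt ht
  have hpow : ε ^ b₀ ≤ t ^ b₀ := Real.rpow_le_rpow hε ht.le hb₀
  rw [norm_mul, Complex.norm_cpow_eq_rpow_re_of_pos ht0, Complex.norm_exp, Complex.re_mul_ofReal,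
    Complex.neg_re, Complex.sub_re, Complex.one_re, mul_left_comm, ← Real.exp_add]
  gcongr
  nlinarith [mul_le_mul_of_nonneg_left hpow hμ]

/-- absolute convergence and the upper incomplete Gamma bound
`|∫_ε^∞ t^{b₁−1} e^{−μ t^{b₀}} dt| ≤ (Γ((Re b₁)/b₀)/b₀)·(2/Re μ)^{(Re b₁)/b₀}·e^{−(Re μ)ε^{b₀}/2}`. -/
theorem stmt0 (b₀ ε : ℝ) (hb₀ : 0 < b₀) (hε : 0 < ε) (b₁ μ : ℂ)
    (hb₁ : 0 < b₁.re) (hμ : 0 < μ.re) :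
    IntegrableOn (fun t : ℝ => (t : ℂ) ^ (b₁ - 1) * Complex.exp (-μ * ((t ^ b₀ : ℝ) : ℂ)))
      (Set.Ioi ε) volume ∧
    ‖∫ t in Set.Ioi ε, (t : ℂ) ^ (b₁ - 1) * Complex.exp (-μ * ((t ^ b₀ : ℝ) : ℂ))‖ ≤
      Real.Gamma (b₁.re / b₀) / b₀ * (2 / μ.re) ^ (b₁.re / b₀) *
        Real.exp (-(μ.re * ε ^ b₀) / 2) := by
  set g : ℝ → ℝ := fun t => t ^ (b₁.re - 1) * Real.exp (-(μ.re / 2) * t ^ b₀)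
  set C : ℝ := Real.exp (-(μ.re * ε ^ b₀) / 2)
  have hg : IntegrableOn g (Ioi 0) :=
    integrableOn_rpow_mul_exp_neg_mul_rpow (by linarith) hb₀ (half_pos hμ)
  have hgε : IntegrableOn (fun t => C * g t) (Ioi ε) :=
    (hg.mono_set (Ioi_subset_Ioi hε.le)).const_mul C
  have hbound : ∀ᵐ t : ℝ ∂volume.restrict (Ioi ε),
      ‖(t : ℂ) ^ (b₁ - 1) * Complex.exp (-μ * ((t ^ b₀ : ℝ) : ℂ))‖ ≤ C * g t :=
    (ae_restrict_mem measurableSet_Ioi).mono fun t ht =>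
      norm_cpow_mul_exp_neg_mul_rpow_le hb₀.le hε.le ht b₁ hμ.le
  refine ⟨hgε.mono' (by fun_prop) hbound, (norm_integral_le_of_norm_le hgε hbound).trans ?_⟩
  calc ∫ t in Ioi ε, C * g t = C * ∫ t in Ioi ε, g t := integral_const_mul _ _
    _ ≤ C * ∫ t in Ioi 0, g t := by
        refine mul_le_mul_of_nonneg_left ?_ (Real.exp_pos _).le
        refine setIntegral_mono_set hg ?_ (Ioi_subset_Ioi hε.le).eventuallyLE
        filter_upwards [ae_restrict_mem measurableSet_Ioi] with t ht
        exact mul_nonneg (Real.rpow_nonneg (le_of_lt ht) _) (Real.exp_pos _).le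
    _ = _ := by
        rw [integral_rpow_mul_exp_neg_mul_rpow hb₀ (by linarith) (half_pos hμ), sub_add_cancel,
          neg_div, Real.rpow_neg (half_pos hμ).le, ← Real.inv_rpow (half_pos hμ).le, inv_div]
        ring
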